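/- There exists a constant C > 0, depending only on the data (u_T, m₀, L, T, σ, r, ε), such that every smooth solution (u,m) of the MFG system satisfies 0 ≤ u_x(t,x) ≤ C for all (t,x) ∈ [0,T]×[0,L]. -/

import Mathlib

open Set MeasureTheory intervalIntegral Function

noncomputable section

/-- Spatial derivative `u_x`. -/
def pdx (u : ℝ → ℝ → ℝ) (t x : ℝ) : ℝ := deriv (u t) x

/-- Second spatial derivative `u_xx`. -/
def pdxx (u : ℝ → ℝ → ℝ) (t x : ℝ) : ℝ := deriv (deriv (u t)) x

/-- Time derivative `u_t`. -/
def pdt (u : ℝ → ℝ → ℝ) (t x : ℝ) : ℝ := deriv (fun s => u s x) t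

/-- `η(t) = ∫₀^L m(t,x) dx`. -/
def mfgEta (L : ℝ) (m : ℝ → ℝ → ℝ) (t : ℝ) : ℝ := ∫ x in (0:ℝ)..L, m t x

/-- `f(t) = a(η(t)) + c(η(t)) p̄(t)`. -/
def mfgF (L ε : ℝ) (u m : ℝ → ℝ → ℝ) (t : ℝ) : ℝ :=
  2 / (2 + ε * mfgEta L m t)
    + (ε / (2 + ε * mfgEta L m t)) * ∫ x in (0:ℝ)..L, pdx u t x * m t x

/-- `G(t,x) = (1/2)(f(t) − u_x(t,x))`. -/
def mfgG (L ε : ℝ) (u m : ℝ → ℝ → ℝ) (t x : ℝ) : ℝ :=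
  (1/2) * (mfgF L ε u m t - pdx u t x)

/-- `H(t,x) = G(t,x)²`. -/
def mfgH (L ε : ℝ) (u m : ℝ → ℝ → ℝ) (t x : ℝ) : ℝ := (mfgG L ε u m t x)^2

/-- Standing assumptions on the data. -/
structure MFGData (T L σ r ε : ℝ) (uT m0 : ℝ → ℝ) : Prop where
  hT : 0 < T
  hL : 0 < L
  hσ : 0 < σ
  hr : 0 < r
  hε : 0 ≤ ε
  uT_smooth : ContDiff ℝ 2 uT
  m0_smooth : ContDiff ℝ 2 m0
  uT_zero : uT 0 = 0
  uT_deriv_L : deriv uT L = 0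
  uT_nonneg : ∀ x ∈ Icc (0:ℝ) L, 0 ≤ uT x
  uT_deriv_nonneg : ∀ x ∈ Icc (0:ℝ) L, 0 ≤ deriv uT x
  m0_zero : m0 0 = 0
  m0_L : m0 L = 0
  m0_deriv_L : deriv m0 L = 0
  m0_nonneg : ∀ x ∈ Icc (0:ℝ) L, 0 ≤ m0 x
  m0_mass : (∫ x in (0:ℝ)..L, m0 x) = 1

/-- A smooth solution of the MFG system \eqref{main system}. -/
structure IsMFGSolution (T L σ r ε : ℝ) (uT m0 : ℝ → ℝ) (u m : ℝ → ℝ → ℝ) : Prop where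
  u_smooth : ContDiff ℝ (⊤ : ℕ∞) (uncurry u)
  m_smooth : ContDiff ℝ (⊤ : ℕ∞) (uncurry m)
  hjb : ∀ t ∈ Ioo (0:ℝ) T, ∀ x ∈ Ioo (0:ℝ) L,
    pdt u t x + σ^2/2 * pdxx u t x - r * u t x + mfgH L ε u m t x = 0
  fp : ∀ t ∈ Ioo (0:ℝ) T, ∀ x ∈ Ioo (0:ℝ) L,
    pdt m t x - σ^2/2 * pdxx m t x
      - deriv (fun y => mfgG L ε u m t y * m t y) x = 0
  m_init : ∀ x ∈ Icc (0:ℝ) L, m 0 x = m0 x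
  u_term : ∀ x ∈ Icc (0:ℝ) L, u T x = uT x
  u_bdry : ∀ t ∈ Icc (0:ℝ) T, u t 0 = 0
  m_bdry : ∀ t ∈ Icc (0:ℝ) T, m t 0 = 0
  ux_bdry : ∀ t ∈ Icc (0:ℝ) T, pdx u t L = 0
  m_flux : ∀ t ∈ Icc (0:ℝ) T,
    σ^2/2 * pdx m t L + mfgG L ε u m t L * m t L = 0

end

section Calculus

variable {g : ℝ → ℝ → ℝ}

lemma hasDerivAt_space (hg : ContDiff ℝ 1 (uncurry g)) (t x : ℝ) :
    HasDerivAt (g t) (pdx g t x) x := by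
  have h : DifferentiableAt ℝ (g t) x := by
    have : g t = uncurry g ∘ fun y => (t, y) := rfl
    rw [this]
    exact ((hg.differentiable one_ne_zero) _).comp x (by fun_prop)
  exact h.hasDerivAt

lemma hasDerivAt_time (hg : ContDiff ℝ 1 (uncurry g)) (t x : ℝ) :
    HasDerivAt (fun s => g s x) (pdt g t x) t := by
  have h : DifferentiableAt ℝ (fun s => g s x) t := by
    have : (fun s => g s x) = uncurry g ∘ fun s => (s, x) := rfl
    rw [this]
    exact ((hg.differentiable one_ne_zero) _).comp t (by fun_prop)
  exact h.hasDerivAt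

lemma pdx_eq_fderiv (hg : ContDiff ℝ 1 (uncurry g)) (t x : ℝ) :
    pdx g t x = fderiv ℝ (uncurry g) (t, x) (0, 1) := by
  have h := ((hg.differentiable one_ne_zero) (t, x)).hasFDerivAt.comp_hasDerivAt x
    ((hasDerivAt_const x t).prodMk (hasDerivAt_id x))
  exact (hasDerivAt_space hg t x).unique h

lemma pdt_eq_fderiv (hg : ContDiff ℝ 1 (uncurry g)) (t x : ℝ) :
    pdt g t x = fderiv ℝ (uncurry g) (t, x) (1, 0) := by
  have h := ((hg.differentiable one_ne_zero) (t, x)).hasFDerivAt.comp_hasDerivAt t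
    ((hasDerivAt_id t).prodMk (hasDerivAt_const t x))
  exact (hasDerivAt_time hg t x).unique h

lemma uncurry_pdx_eq (hg : ContDiff ℝ 1 (uncurry g)) :
    uncurry (pdx g) = fun p => fderiv ℝ (uncurry g) p (0, 1) := by
  ext ⟨t, x⟩
  exact pdx_eq_fderiv hg t x

lemma uncurry_pdt_eq (hg : ContDiff ℝ 1 (uncurry g)) :
    uncurry (pdt g) = fun p => fderiv ℝ (uncurry g) p (1, 0) := by
  ext ⟨t, x⟩
  exact pdt_eq_fderiv hg t x

lemma continuous_pdt (hg : ContDiff ℝ 1 (uncurry g)) : Continuous (uncurry (pdt g)) := by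
  rw [uncurry_pdt_eq hg]
  exact (hg.continuous_fderiv one_ne_zero).clm_apply continuous_const

lemma contDiff_pdx (hg : ContDiff ℝ (⊤ : ℕ∞) (uncurry g)) :
    ContDiff ℝ (⊤ : ℕ∞) (uncurry (pdx g)) := by
  rw [uncurry_pdx_eq (hg.of_le (by exact_mod_cast le_top))]
  exact (hg.fderiv_right (m := (⊤ : ℕ∞)) (by simp)).clm_apply contDiff_const

lemma contDiff_pdt (hg : ContDiff ℝ (⊤ : ℕ∞) (uncurry g)) :
    ContDiff ℝ (⊤ : ℕ∞) (uncurry (pdt g)) := by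
  rw [uncurry_pdt_eq (hg.of_le (by exact_mod_cast le_top))]
  exact (hg.fderiv_right (m := (⊤ : ℕ∞)) (by simp)).clm_apply contDiff_const

lemma pdx_pdt_comm (hg : ContDiff ℝ (⊤ : ℕ∞) (uncurry g)) (t x : ℝ) :
    pdx (pdt g) t x = pdt (pdx g) t x := by
  have h1 : ContDiff ℝ 1 (uncurry g) := hg.of_le (by exact_mod_cast le_top)
  have hd : DifferentiableAt ℝ (fderiv ℝ (uncurry g)) (t, x) :=
    (hg.fderiv_right (m := (⊤ : ℕ∞)) (by simp)).differentiable (by simp) _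
  rw [pdx_eq_fderiv ((contDiff_pdt hg).of_le (by exact_mod_cast le_top)),
    pdt_eq_fderiv ((contDiff_pdx hg).of_le (by exact_mod_cast le_top)),
    uncurry_pdx_eq h1, uncurry_pdt_eq h1]
  have key : ∀ v w : ℝ × ℝ, fderiv ℝ (fun p => fderiv ℝ (uncurry g) p v) (t, x) w
      = fderiv ℝ (fderiv ℝ (uncurry g)) (t, x) w v := by
    intro v w
    rw [fderiv_clm_apply hd (differentiableAt_const v)]
    simp
  rw [key, key]
  exact (hg.contDiffAt.isSymmSndFDerivAt (by
    rw [minSmoothness_of_isRCLikeNormedField]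
    exact WithTop.coe_le_coe.2 (le_top : (2 : ℕ∞) ≤ ⊤))).eq _ _

lemma continuous_slice (hg : Continuous (uncurry g)) (t : ℝ) : Continuous (g t) :=
  hg.comp (Continuous.prodMk_right t)

/-- Differentiation under the integral sign for a jointly `C¹` integrand. -/
lemma hasDerivAt_integral_of_contDiff (hg : ContDiff ℝ 1 (uncurry g)) (a b t : ℝ) :
    HasDerivAt (fun s => ∫ x in a..b, g s x) (∫ x in a..b, pdt g t x) t := by
  have hc := continuous_pdt hg
  obtain ⟨C, hC⟩ := ((isCompact_Icc (a := t - 1) (b := t + 1)).prod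
    (isCompact_uIcc (a := a) (b := b))).exists_bound_of_continuousOn hc.continuousOn
  refine (intervalIntegral.hasDerivAt_integral_of_dominated_loc_of_deriv_le
    (F := g) (F' := pdt g) (bound := fun _ => C) (s := Icc (t - 1) (t + 1))
    (Icc_mem_nhds (by linarith) (by linarith)) ?_ ?_ ?_ ?_ ?_ ?_).2
  · exact Filter.Eventually.of_forall fun s =>
      (continuous_slice hg.continuous s).aestronglyMeasurable
  · exact (continuous_slice hg.continuous t).intervalIntegrable _ _
  · exact (continuous_slice hc t).aestronglyMeasurable
  · exact Filter.Eventually.of_forall fun x hx s hs => hC (s, x) ⟨hs, uIoc_subset_uIcc hx⟩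
  · exact intervalIntegrable_const
  · exact Filter.Eventually.of_forall fun x _ s _ => hasDerivAt_time hg s x

end Calculus

section Extrema

lemma deriv_nonneg_of_forall_le {f : ℝ → ℝ} {f' a b : ℝ} (hab : a < b) (hf : HasDerivAt f f' a)
    (hmin : ∀ s ∈ Icc a b, f a ≤ f s) : 0 ≤ f' := by
  by_contra! hlt
  have h := (hasDerivAt_iff_tendsto_slope.1 hf).mono_left
    (nhdsWithin_mono a (fun s (hs : s ∈ Ioi a) => ne_of_gt hs))
  have h2 : ∀ᶠ s in nhdsWithin a (Ioi a), slope f a s < 0 := h.eventually (gt_mem_nhds hlt)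
  obtain ⟨s, hs, hs'⟩ := (h2.and (Ioo_mem_nhdsGT hab)).exists
  rw [slope_def_field, div_neg_iff] at hs
  have := hmin s ⟨hs'.1.le, hs'.2.le⟩
  rcases hs with h | h <;> linarith [hs'.1]

lemma deriv_nonpos_of_forall_le {f : ℝ → ℝ} {f' a b : ℝ} (hab : a < b) (hf : HasDerivAt f f' b)
    (hmin : ∀ s ∈ Icc a b, f b ≤ f s) : f' ≤ 0 := by
  have h : HasDerivAt (fun s => f (-s)) (-f') (-b) := by
    have h1 : HasDerivAt f f' (-(-b)) := by simpa using hf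
    have := h1.comp (-b) (hasDerivAt_neg (-b))
    simpa [Function.comp_def] using this
  have := deriv_nonneg_of_forall_le (neg_lt_neg hab) h (fun s hs => by
    simpa using hmin (-s) ⟨by linarith [hs.2], by linarith [hs.1]⟩)
  linarith

lemma second_deriv_nonneg_of_forall_le {f f' : ℝ → ℝ} {f'' a b : ℝ} (hab : a < b)
    (hf : ∀ x ∈ Icc a b, HasDerivAt f (f' x) x) (hf' : HasDerivAt f' f'' b) (h0 : f' b = 0)
    (hmin : ∀ s ∈ Icc a b, f b ≤ f s) : 0 ≤ f'' := by
  by_contra! hlt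
  have h := (hasDerivAt_iff_tendsto_slope.1 hf').mono_left
    (nhdsWithin_mono b (fun s (hs : s ∈ Iio b) => ne_of_lt hs))
  have h2 : ∀ᶠ s in nhdsWithin b (Iio b), slope f' b s < 0 := h.eventually (gt_mem_nhds hlt)
  obtain ⟨l, hl, hl'⟩ := (mem_nhdsLT_iff_exists_Ioo_subset' hab).1 (h2.and (Ioo_mem_nhdsLT hab))
  have hpos : ∀ s ∈ Ioo l b, 0 < f' s := by
    intro s hs
    have h3 := (hl' hs).1
    rw [slope_def_field, div_neg_iff, h0] at h3
    rcases h3 with h | h <;> linarith [hs.2]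
  set c := (max a l + b) / 2 with hc
  have hmax : max a l < b := max_lt hab hl
  have hac := le_max_left a l
  have hlc := le_max_right a l
  have hcb : c < b := by linarith
  have hmono : StrictMonoOn f (Icc c b) := by
    apply strictMonoOn_of_deriv_pos (convex_Icc c b)
    · exact fun x hx => (hf x ⟨by linarith [hx.1], hx.2⟩).continuousAt.continuousWithinAt
    · intro x hx
      rw [interior_Icc] at hx
      rw [(hf x ⟨by linarith [hx.1], hx.2.le⟩).deriv]
      exact hpos x ⟨by linarith [hx.1], hx.2⟩
  have h5 := hmono (left_mem_Icc.2 hcb.le) (right_mem_Icc.2 hcb.le) hcb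
  linarith [hmin c ⟨by linarith, hcb.le⟩]

/-- A parabolic minimum principle (backward in time): at a negative minimum away from the
parabolic boundary, the derivatives of `w` have the expected signs. -/
lemma parabolic_nonneg {a b l : ℝ} (hl : 0 < l) {w wt wx wxx : ℝ → ℝ → ℝ}
    (hw : ContinuousOn (uncurry w) (Icc a b ×ˢ Icc 0 l))
    (hwt : ∀ t ∈ Ico a b, ∀ x ∈ Ioc 0 l, HasDerivAt (fun s => w s x) (wt t x) t)
    (hwx : ∀ t ∈ Ico a b, ∀ x ∈ Icc 0 l, HasDerivAt (w t) (wx t x) x)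
    (hwxx : ∀ t ∈ Ico a b, ∀ x ∈ Ioc 0 l, HasDerivAt (wx t) (wxx t x) x)
    (hterm : ∀ x ∈ Icc 0 l, 0 ≤ w b x)
    (hleft : ∀ t ∈ Ico a b, 0 ≤ w t 0)
    (hright : ∀ t ∈ Ico a b, 0 ≤ w t l ∨ wx t l = 0)
    (hcontra : ∀ t ∈ Ico a b, ∀ x ∈ Ioc 0 l, w t x < 0 → wx t x = 0 → 0 ≤ wt t x →
      0 ≤ wxx t x → False) :
    ∀ t ∈ Icc a b, ∀ x ∈ Icc 0 l, 0 ≤ w t x := by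
  intro t₁ ht₁ x₁ hx₁
  by_contra! hneg
  obtain ⟨⟨t, x⟩, ⟨ht, hx⟩, hmin⟩ := (isCompact_Icc.prod isCompact_Icc).exists_isMinOn
    ⟨(t₁, x₁), ht₁, hx₁⟩ hw
  have hmin' : ∀ s ∈ Icc a b, ∀ y ∈ Icc 0 l, w t x ≤ w s y := fun s hs y hy =>
    hmin (a := (s, y)) ⟨hs, hy⟩
  have hlt : w t x < 0 := (hmin' t₁ ht₁ x₁ hx₁).trans_lt hneg
  have htb : t < b := lt_of_le_of_ne ht.2 fun h => by
    subst h; exact absurd (hterm x hx) (not_le.2 hlt)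
  have htI : t ∈ Ico a b := ⟨ht.1, htb⟩
  have hx0 : 0 < x := lt_of_le_of_ne hx.1 fun h => by
    subst h; exact absurd (hleft t htI) (not_le.2 hlt)
  have hxI : x ∈ Ioc 0 l := ⟨hx0, hx.2⟩
  have hwx0 : wx t x = 0 := by
    rcases hx.2.eq_or_lt with h | h
    · subst h
      exact (hright t htI).resolve_left (not_le.2 hlt)
    · refine le_antisymm ?_ ?_
      · exact deriv_nonpos_of_forall_le hx0 (hwx t htI x hx)
          fun s hs => hmin' t ht s ⟨hs.1, hs.2.trans hx.2⟩
      · exact deriv_nonneg_of_forall_le h (hwx t htI x hx)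
          fun s hs => hmin' t ht s ⟨hx.1.trans hs.1, hs.2⟩
  refine hcontra t htI x hxI hlt hwx0 ?_ ?_
  · exact deriv_nonneg_of_forall_le htb (hwt t htI x hxI)
      fun s hs => hmin' s ⟨ht.1.trans hs.1, hs.2⟩ x hx
  · exact second_deriv_nonneg_of_forall_le hx0 (fun y hy => hwx t htI y ⟨hy.1, hy.2.trans hx.2⟩)
      (hwxx t htI x hxI) hwx0 fun s hs => hmin' t ht s ⟨hs.1, hs.2.trans hx.2⟩

end Extrema

section Solution

lemma eqOn_Icc_of_eqOn_Ioo {l : ℝ} (hl : 0 < l) {f g : ℝ → ℝ} (hf : Continuous f)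
    (hg : Continuous g) (h : ∀ x ∈ Ioo 0 l, f x = g x) : ∀ x ∈ Icc 0 l, f x = g x := by
  have := Set.EqOn.closure (s := Ioo 0 l) (f := f) (g := g) h hf hg
  rwa [closure_Ioo hl.ne] at this

variable {T L σ r ε : ℝ} {uT m0 : ℝ → ℝ} {u m : ℝ → ℝ → ℝ}

namespace IsMFGSolution

lemma u_contDiff (h : IsMFGSolution T L σ r ε uT m0 u m) : ContDiff ℝ 1 (uncurry u) :=
  h.u_smooth.of_le (by exact_mod_cast le_top)

lemma m_contDiff (h : IsMFGSolution T L σ r ε uT m0 u m) : ContDiff ℝ 1 (uncurry m) :=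
  h.m_smooth.of_le (by exact_mod_cast le_top)

lemma pdx_u_contDiff (h : IsMFGSolution T L σ r ε uT m0 u m) :
    ContDiff ℝ 1 (uncurry (pdx u)) :=
  (contDiff_pdx h.u_smooth).of_le (by exact_mod_cast le_top)

lemma pdx_m_contDiff (h : IsMFGSolution T L σ r ε uT m0 u m) :
    ContDiff ℝ 1 (uncurry (pdx m)) :=
  (contDiff_pdx h.m_smooth).of_le (by exact_mod_cast le_top)

lemma pdt_u_contDiff (h : IsMFGSolution T L σ r ε uT m0 u m) :
    ContDiff ℝ 1 (uncurry (pdt u)) :=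
  (contDiff_pdt h.u_smooth).of_le (by exact_mod_cast le_top)

lemma pdxx_u_contDiff (h : IsMFGSolution T L σ r ε uT m0 u m) :
    ContDiff ℝ 1 (uncurry (pdxx u)) :=
  (contDiff_pdx (contDiff_pdx h.u_smooth)).of_le (by exact_mod_cast le_top)

lemma continuous_pdxx_m (h : IsMFGSolution T L σ r ε uT m0 u m) :
    Continuous (uncurry (pdxx m)) :=
  (contDiff_pdx (contDiff_pdx h.m_smooth)).continuous

lemma hasDerivAt_pdx_u (h : IsMFGSolution T L σ r ε uT m0 u m) (t x : ℝ) :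
    HasDerivAt (pdx u t) (pdxx u t x) x :=
  hasDerivAt_space h.pdx_u_contDiff t x

lemma hasDerivAt_mfgG (h : IsMFGSolution T L σ r ε uT m0 u m) (t x : ℝ) :
    HasDerivAt (mfgG L ε u m t) (-(1 / 2) * pdxx u t x) x := by
  have := ((h.hasDerivAt_pdx_u t x).const_sub (mfgF L ε u m t)).const_mul (1 / 2)
  exact this.congr_deriv (by ring)

lemma continuous_mfgG (h : IsMFGSolution T L σ r ε uT m0 u m) (t : ℝ) :
    Continuous (mfgG L ε u m t) :=
  continuous_iff_continuousAt.2 fun x => (h.hasDerivAt_mfgG t x).continuousAt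

lemma hjb_Icc (h : IsMFGSolution T L σ r ε uT m0 u m) (hL : 0 < L) {t : ℝ}
    (ht : t ∈ Ioo 0 T) : ∀ x ∈ Icc 0 L,
    pdt u t x + σ ^ 2 / 2 * pdxx u t x - r * u t x + mfgG L ε u m t x ^ 2 = 0 := by
  have h1 := continuous_slice h.pdt_u_contDiff.continuous t
  have h2 := continuous_slice h.pdxx_u_contDiff.continuous t
  have h3 := continuous_slice h.u_contDiff.continuous t
  have h4 := h.continuous_mfgG t
  exact eqOn_Icc_of_eqOn_Ioo (g := fun _ => 0) hL (by fun_prop) continuous_const (h.hjb t ht)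

/-- The flux of the Fokker-Planck equation. -/
lemma hasDerivAt_flux (h : IsMFGSolution T L σ r ε uT m0 u m) (hL : 0 < L) {t : ℝ}
    (ht : t ∈ Ioo 0 T) : ∀ x ∈ Icc 0 L,
    HasDerivAt (fun y => σ ^ 2 / 2 * pdx m t y + mfgG L ε u m t y * m t y) (pdt m t x) x := by
  have hm : ∀ x, HasDerivAt (m t) (pdx m t x) x := hasDerivAt_space h.m_contDiff t
  have hmx : ∀ x, HasDerivAt (pdx m t) (pdxx m t x) x := hasDerivAt_space h.pdx_m_contDiff t
  have hGm : ∀ x, HasDerivAt (fun y => mfgG L ε u m t y * m t y)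
      (-(1 / 2) * pdxx u t x * m t x + mfgG L ε u m t x * pdx m t x) x := fun x =>
    (h.hasDerivAt_mfgG t x).mul (hm x)
  have h1 := continuous_slice (continuous_pdt h.m_contDiff) t
  have h2 := continuous_slice h.pdxx_u_contDiff.continuous t
  have h3 := continuous_slice h.m_contDiff.continuous t
  have h4 := h.continuous_mfgG t
  have h5 := continuous_slice h.pdx_m_contDiff.continuous t
  have h6 := continuous_slice h.continuous_pdxx_m t
  have key : ∀ x ∈ Icc 0 L, pdt m t x = σ ^ 2 / 2 * pdxx m t x +
      (-(1 / 2) * pdxx u t x * m t x + mfgG L ε u m t x * pdx m t x) := by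
    refine eqOn_Icc_of_eqOn_Ioo hL h1 (by fun_prop) fun x hx => ?_
    have := h.fp t ht x hx
    rw [(hGm x).deriv] at this
    linarith
  intro x hx
  rw [key x hx]
  exact ((hmx x).const_mul _).add (hGm x)

/-- The weak formulation of the Fokker-Planck equation at a fixed time. -/
lemma integral_mul_pdt_m (h : IsMFGSolution T L σ r ε uT m0 u m) (hL : 0 < L) {t : ℝ}
    (ht : t ∈ Ioo 0 T) {ψ ψ' : ℝ → ℝ} (hψ : ∀ x, HasDerivAt ψ (ψ' x) x) (hψ' : Continuous ψ') :
    ∫ x in (0:ℝ)..L, ψ x * pdt m t x = -(ψ 0 * (σ ^ 2 / 2 * pdx m t 0)) -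
      ∫ x in (0:ℝ)..L, ψ' x * (σ ^ 2 / 2 * pdx m t x + mfgG L ε u m t x * m t x) := by
  have ht' : t ∈ Icc 0 T := ⟨ht.1.le, ht.2.le⟩
  rw [intervalIntegral.integral_mul_deriv_eq_deriv_mul (fun x _ => hψ x)
    (fun x hx => h.hasDerivAt_flux hL ht x (by rwa [uIcc_of_le hL.le] at hx))
    (hψ'.intervalIntegrable _ _)
    ((continuous_slice (continuous_pdt h.m_contDiff) t).intervalIntegrable _ _),
    h.m_flux t ht', h.m_bdry t ht']
  ring

lemma continuous_integral_comp_m (h : IsMFGSolution T L σ r ε uT m0 u m) {q : ℝ → ℝ}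
    (hq : Continuous q) : Continuous fun t => ∫ x in (0:ℝ)..L, q (m t x) :=
  intervalIntegral.continuous_parametric_intervalIntegral_of_continuous'
    (f := fun t x => q (m t x)) (hq.comp h.m_contDiff.continuous) _ _

/-- Evolution of `∫ q(m)` along the Fokker-Planck equation. -/
lemma hasDerivAt_integral_comp_m (h : IsMFGSolution T L σ r ε uT m0 u m) (hL : 0 < L) {t : ℝ}
    (ht : t ∈ Ioo 0 T) {q q' q'' : ℝ → ℝ} (hq : ∀ s, HasDerivAt q (q' s) s)
    (hq' : ∀ s, HasDerivAt q' (q'' s) s) (hq'' : Continuous q'') :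
    HasDerivAt (fun t => ∫ x in (0:ℝ)..L, q (m t x))
      (-(q' 0 * (σ ^ 2 / 2 * pdx m t 0)) - ∫ x in (0:ℝ)..L, q'' (m t x) * pdx m t x *
        (σ ^ 2 / 2 * pdx m t x + mfgG L ε u m t x * m t x)) t := by
  have hq1 : ContDiff ℝ 1 q := by
    refine contDiff_one_iff_deriv.2 ⟨fun s => (hq s).differentiableAt, ?_⟩
    rw [show deriv q = q' from funext fun s => (hq s).deriv]
    exact continuous_iff_continuousAt.2 fun s => (hq' s).continuousAt
  have hd := hasDerivAt_integral_of_contDiff (g := fun t x => q (m t x))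
    (hq1.comp h.m_contDiff) 0 L t
  refine hd.congr_deriv ?_
  have h0 : m t 0 = 0 := h.m_bdry t ⟨ht.1.le, ht.2.le⟩
  have hmx := continuous_slice h.pdx_m_contDiff.continuous t
  have hm := continuous_slice h.m_contDiff.continuous t
  have := h.integral_mul_pdt_m hL ht (ψ := fun x => q' (m t x))
    (ψ' := fun x => q'' (m t x) * pdx m t x)
    (fun x => (hq' (m t x)).comp x (hasDerivAt_space h.m_contDiff t x))
    ((hq''.comp hm).mul hmx)
  rw [h0] at this
  rw [← this]
  refine intervalIntegral.integral_congr fun x _ => ?_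
  exact ((hq (m t x)).comp t (hasDerivAt_time h.m_contDiff t x)).deriv

lemma deriv_integral_comp_m_le (h : IsMFGSolution T L σ r ε uT m0 u m) (hL : 0 < L) (hσ : 0 < σ)
    {t : ℝ} (ht : t ∈ Ioo 0 T) {q q' q'' : ℝ → ℝ} (hq : ∀ s, HasDerivAt q (q' s) s)
    (hq' : ∀ s, HasDerivAt q' (q'' s) s) (hq'' : Continuous q'') (hq0 : q' 0 = 0)
    (hconv : ∀ s, 0 ≤ q'' s) :
    deriv (fun t => ∫ x in (0:ℝ)..L, q (m t x)) t ≤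
      1 / (2 * σ ^ 2) * ∫ x in (0:ℝ)..L, q'' (m t x) * m t x ^ 2 * mfgG L ε u m t x ^ 2 := by
  rw [(h.hasDerivAt_integral_comp_m hL ht hq hq' hq'').deriv, hq0, zero_mul, neg_zero, zero_sub,
    ← intervalIntegral.integral_neg, ← intervalIntegral.integral_const_mul]
  have h3 := continuous_slice h.m_contDiff.continuous t
  have h4 := h.continuous_mfgG t
  have h5 := continuous_slice h.pdx_m_contDiff.continuous t
  refine intervalIntegral.integral_mono_on hL.le
    (Continuous.intervalIntegrable (by fun_prop) _ _)
    (Continuous.intervalIntegrable (by fun_prop) _ _) fun x _ => ?_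
  have hs := mul_nonneg (hconv (m t x))
    (sq_nonneg (σ * pdx m t x + mfgG L ε u m t x * m t x / σ))
  have e : (σ * pdx m t x + mfgG L ε u m t x * m t x / σ) ^ 2 =
      2 * (pdx m t x * (σ ^ 2 / 2 * pdx m t x + mfgG L ε u m t x * m t x))
        + 1 / σ ^ 2 * (m t x ^ 2 * mfgG L ε u m t x ^ 2) := by
    field_simp; ring
  rw [e] at hs
  have e2 : 1 / (2 * σ ^ 2) * (q'' (m t x) * m t x ^ 2 * mfgG L ε u m t x ^ 2) =
      q'' (m t x) * (1 / σ ^ 2 * (m t x ^ 2 * mfgG L ε u m t x ^ 2)) / 2 := by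
    field_simp
  rw [e2]
  linarith

lemma hjb_pdx (h : IsMFGSolution T L σ r ε uT m0 u m) {t : ℝ}
    (ht : t ∈ Ioo 0 T) : ∀ x ∈ Ioo 0 L,
    pdt (pdx u) t x + σ ^ 2 / 2 * pdx (pdxx u) t x - r * pdx u t x
      - mfgG L ε u m t x * pdxx u t x = 0 := by
  intro x hx
  have h1 : HasDerivAt (pdt u t) (pdt (pdx u) t x) x := by
    rw [← pdx_pdt_comm h.u_smooth]
    exact hasDerivAt_space h.pdt_u_contDiff t x
  have h2 := ((h1.add ((hasDerivAt_space h.pdxx_u_contDiff t x).const_mul (σ ^ 2 / 2))).sub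
    ((hasDerivAt_space h.u_contDiff t x).const_mul r)).add ((h.hasDerivAt_mfgG t x).pow 2)
  have h3 := h2.congr_of_eventuallyEq (f₁ := fun _ => (0 : ℝ)) (by
    filter_upwards [isOpen_Ioo.mem_nhds hx] with y hy
    exact (h.hjb t ht y hy).symm)
  have := h3.unique (hasDerivAt_const x (0 : ℝ))
  simp only [Nat.cast_ofNat, Nat.add_one_sub_one, pow_one] at this
  linarith

lemma pdx_u_terminal (h : IsMFGSolution T L σ r ε uT m0 u m)
    (hd : MFGData T L σ r ε uT m0) : ∀ x ∈ Icc 0 L, pdx u T x = deriv uT x := by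
  intro x hx
  have hu := (uniqueDiffOn_Icc hd.hL) x hx
  have h1 := (hasDerivAt_space h.u_contDiff T x).hasDerivWithinAt (s := Icc 0 L)
  have h2 := ((hd.uT_smooth.differentiable (by simp)) x).hasDerivAt.hasDerivWithinAt
    (s := Icc 0 L)
  exact hu.eq_deriv _ h1 (h2.congr h.u_term (h.u_term x hx))

lemma nonneg_Icc_of_nonneg_Ioc (hT : 0 < T) {f : ℝ → ℝ} (hf : Continuous f)
    (hpos : ∀ t ∈ Ioc 0 T, 0 ≤ f t) : ∀ t ∈ Icc 0 T, 0 ≤ f t := by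
  intro t ht
  rw [← closure_Ioc hT.ne] at ht
  exact le_on_closure hpos continuousOn_const hf.continuousOn ht

lemma continuous_time_slice {g : ℝ → ℝ → ℝ} (hg : Continuous (uncurry g)) (x : ℝ) :
    Continuous fun t => g t x :=
  hg.comp (Continuous.prodMk_left x)

lemma u_nonneg (h : IsMFGSolution T L σ r ε uT m0 u m)
    (hd : MFGData T L σ r ε uT m0) : ∀ t ∈ Icc 0 T, ∀ x ∈ Icc 0 L, 0 ≤ u t x := by
  intro t ht x hx
  refine nonneg_Icc_of_nonneg_Ioc hd.hT (continuous_time_slice h.u_contDiff.continuous x)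
    (fun t₀ ht₀ => ?_) t ht
  have hsub : ∀ t ∈ Ico t₀ T, t ∈ Ioo 0 T := fun t ht => ⟨ht₀.1.trans_le ht.1, ht.2⟩
  refine parabolic_nonneg (a := t₀) (b := T) (l := L) hd.hL (w := u)
    (wt := pdt u) (wx := pdx u) (wxx := pdxx u) h.u_contDiff.continuous.continuousOn
    (fun t _ x _ => hasDerivAt_time h.u_contDiff t x)
    (fun t _ x _ => hasDerivAt_space h.u_contDiff t x)
    (fun t _ x _ => h.hasDerivAt_pdx_u t x)
    (fun x hx => by rw [h.u_term x hx]; exact hd.uT_nonneg x hx)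
    (fun t ht => (h.u_bdry t ⟨(hsub t ht).1.le, ht.2.le⟩).ge)
    (fun t ht => Or.inr (h.ux_bdry t ⟨(hsub t ht).1.le, ht.2.le⟩))
    ?_ t₀ ⟨le_rfl, ht₀.2⟩ x hx
  intro t ht x hx hneg _ hwt hwxx
  have := h.hjb_Icc hd.hL (hsub t ht) x ⟨hx.1.le, hx.2⟩
  have hσ := hd.hσ
  have hr := mul_neg_of_pos_of_neg hd.hr hneg
  have : 0 ≤ σ ^ 2 / 2 * pdxx u t x := by positivity
  nlinarith [sq_nonneg (mfgG L ε u m t x)]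

lemma pdx_u_zero_nonneg (h : IsMFGSolution T L σ r ε uT m0 u m)
    (hd : MFGData T L σ r ε uT m0) : ∀ t ∈ Icc 0 T, 0 ≤ pdx u t 0 := fun t ht =>
  deriv_nonneg_of_forall_le hd.hL (hasDerivAt_space h.u_contDiff t 0) fun x hx => by
    rw [h.u_bdry t ht]
    exact h.u_nonneg hd t ht x hx

lemma pdx_u_nonneg (h : IsMFGSolution T L σ r ε uT m0 u m)
    (hd : MFGData T L σ r ε uT m0) : ∀ t ∈ Icc 0 T, ∀ x ∈ Icc 0 L, 0 ≤ pdx u t x := by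
  intro t ht x hx
  refine nonneg_Icc_of_nonneg_Ioc hd.hT (continuous_time_slice h.pdx_u_contDiff.continuous x)
    (fun t₀ ht₀ => ?_) t ht
  have hsub : ∀ t ∈ Ico t₀ T, t ∈ Ioo 0 T := fun t ht => ⟨ht₀.1.trans_le ht.1, ht.2⟩
  refine parabolic_nonneg (a := t₀) (b := T) (l := L) hd.hL (w := pdx u)
    (wt := pdt (pdx u)) (wx := pdxx u) (wxx := pdx (pdxx u))
    h.pdx_u_contDiff.continuous.continuousOn
    (fun t _ x _ => hasDerivAt_time h.pdx_u_contDiff t x)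
    (fun t _ x _ => h.hasDerivAt_pdx_u t x)
    (fun t _ x _ => hasDerivAt_space h.pdxx_u_contDiff t x)
    (fun x hx => by rw [h.pdx_u_terminal hd x hx]; exact hd.uT_deriv_nonneg x hx)
    (fun t ht => h.pdx_u_zero_nonneg hd t ⟨(hsub t ht).1.le, ht.2.le⟩)
    (fun t ht => Or.inl (h.ux_bdry t ⟨(hsub t ht).1.le, ht.2.le⟩).ge)
    ?_ t₀ ⟨le_rfl, ht₀.2⟩ x hx
  intro t ht x hx hneg hwx hwt hwxx
  have hxL : x < L := lt_of_le_of_ne hx.2 fun hxL => by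
    rw [hxL, h.ux_bdry t ⟨(hsub t ht).1.le, ht.2.le⟩] at hneg
    exact lt_irrefl _ hneg
  have h1 := h.hjb_pdx (hsub t ht) x ⟨hx.1, hxL⟩
  rw [hwx] at h1
  have hσ := hd.hσ
  have hr := mul_neg_of_pos_of_neg hd.hr hneg
  have : 0 ≤ σ ^ 2 / 2 * pdx (pdxx u) t x := by positivity
  linarith

/-- A maximum principle for `u_x`. -/
lemma pdx_u_le (h : IsMFGSolution T L σ r ε uT m0 u m)
    (hd : MFGData T L σ r ε uT m0) {B : ℝ} (hB : 0 ≤ B)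
    (hterm : ∀ x ∈ Icc 0 L, deriv uT x ≤ B) (hleft : ∀ t ∈ Ioo 0 T, pdx u t 0 ≤ B) :
    ∀ t ∈ Icc 0 T, ∀ x ∈ Icc 0 L, pdx u t x ≤ B := by
  intro t ht x hx
  rw [← sub_nonneg]
  refine nonneg_Icc_of_nonneg_Ioc hd.hT (f := fun t => B - pdx u t x)
    (continuous_const.sub (continuous_time_slice h.pdx_u_contDiff.continuous x))
    (fun t₀ ht₀ => ?_) t ht
  have hsub : ∀ t ∈ Ico t₀ T, t ∈ Ioo 0 T := fun t ht => ⟨ht₀.1.trans_le ht.1, ht.2⟩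
  refine parabolic_nonneg (a := t₀) (b := T) (l := L) hd.hL (w := fun t x => B - pdx u t x)
    (wt := fun t x => -pdt (pdx u) t x) (wx := fun t x => -pdxx u t x)
    (wxx := fun t x => -pdx (pdxx u) t x)
    (continuous_const.sub h.pdx_u_contDiff.continuous).continuousOn
    (fun t _ x _ => (hasDerivAt_time h.pdx_u_contDiff t x).const_sub B)
    (fun t _ x _ => (h.hasDerivAt_pdx_u t x).const_sub B)
    (fun t _ x _ => (hasDerivAt_space h.pdxx_u_contDiff t x).neg)
    (fun x hx => by
      rw [h.pdx_u_terminal hd x hx]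
      linarith [hterm x hx])
    (fun t ht => by linarith [hleft t (hsub t ht)])
    (fun t ht => Or.inl (by
      rw [h.ux_bdry t ⟨(hsub t ht).1.le, ht.2.le⟩]
      linarith))
    ?_ t₀ ⟨le_rfl, ht₀.2⟩ x hx
  intro t ht x hx hneg hwx hwt hwxx
  have hxL : x < L := lt_of_le_of_ne hx.2 fun hxL => by
    rw [hxL, h.ux_bdry t ⟨(hsub t ht).1.le, ht.2.le⟩] at hneg
    linarith
  have h1 := h.hjb_pdx (hsub t ht) x ⟨hx.1, hxL⟩
  rw [neg_eq_zero.1 hwx] at h1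
  have hr : 0 < r * pdx u t x := mul_pos hd.hr (by linarith)
  have : 0 ≤ σ ^ 2 / 2 * -pdx (pdxx u) t x := mul_nonneg (by positivity) hwxx
  linarith

lemma exists_mfgG_sq_le (h : IsMFGSolution T L σ r ε uT m0 u m) (hL : 0 < L) :
    ∃ B, ∀ t ∈ Ioo 0 T, ∀ x ∈ Icc 0 L, mfgG L ε u m t x ^ 2 ≤ B := by
  have h1 := h.pdt_u_contDiff.continuous
  have h2 := h.pdxx_u_contDiff.continuous
  have h3 := h.u_contDiff.continuous
  have hc : Continuous fun p : ℝ × ℝ => uncurry (pdt u) p + σ ^ 2 / 2 * uncurry (pdxx u) p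
      - r * uncurry u p := by fun_prop
  obtain ⟨B, hB⟩ := ((isCompact_Icc (a := 0) (b := T)).prod
    (isCompact_Icc (a := 0) (b := L))).exists_bound_of_continuousOn hc.continuousOn
  refine ⟨B, fun t ht x hx => ?_⟩
  have h4 := hB (t, x) ⟨⟨ht.1.le, ht.2.le⟩, hx⟩
  have h5 := h.hjb_Icc hL ht x hx
  simp only [uncurry_apply_pair, Real.norm_eq_abs] at h4
  linarith [(abs_le.1 h4).1]

lemma m_nonneg (h : IsMFGSolution T L σ r ε uT m0 u m)
    (hd : MFGData T L σ r ε uT m0) : ∀ t ∈ Icc 0 T, ∀ x ∈ Icc 0 L, 0 ≤ m t x := by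
  have hL := hd.hL
  have hσ := hd.hσ
  obtain ⟨B, hB⟩ := h.exists_mfgG_sq_le hL
  have habs : ∀ s : ℝ, HasDerivAt (fun s : ℝ => s * |s|) (2 * |s|) s := by
    intro s
    rcases lt_trichotomy s 0 with hs | hs | hs
    · have h1 := (hasDerivAt_pow 2 s).neg
      refine (h1.congr_of_eventuallyEq ?_).congr_deriv (by rw [abs_of_neg hs]; simp)
      filter_upwards [gt_mem_nhds hs] with y hy
      simp only [abs_of_neg hy, Pi.neg_apply]; ring
    · subst hs
      rw [hasDerivAt_iff_tendsto_slope]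
      have h2 : Filter.Tendsto (fun s : ℝ => |s|) (nhdsWithin 0 {0}ᶜ) (nhds |0|) :=
        continuous_abs.continuousAt.continuousWithinAt
      simp only [abs_zero, mul_zero] at h2 ⊢
      refine h2.congr' ?_
      filter_upwards [self_mem_nhdsWithin] with y hy
      have : y ≠ 0 := hy
      rw [slope_def_field]
      field_simp
      simp
    · have h1 := hasDerivAt_pow 2 s
      refine (h1.congr_of_eventuallyEq ?_).congr_deriv (by rw [abs_of_pos hs]; simp)
      filter_upwards [lt_mem_nhds hs] with y hy
      simp only [abs_of_pos hy]; ring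
  set q : ℝ → ℝ := fun s => s ^ 4 - s ^ 2 * (s * |s|) with hq_def
  set q' : ℝ → ℝ := fun s => 4 * s ^ 3 - 4 * (s * (s * |s|)) with hq'_def
  set q'' : ℝ → ℝ := fun s => 12 * s ^ 2 - 12 * (s * |s|) with hq''_def
  have hq : ∀ s, HasDerivAt q (q' s) s := fun s =>
    ((hasDerivAt_pow 4 s).sub ((hasDerivAt_pow 2 s).mul (habs s))).congr_deriv (by
      simp only [hq'_def]; push_cast; ring)
  have hq' : ∀ s, HasDerivAt q' (q'' s) s := fun s =>
    (((hasDerivAt_pow 3 s).const_mul 4).sub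
      (((hasDerivAt_id s).mul (habs s)).const_mul 4)).congr_deriv (by
      simp only [hq''_def, id]; push_cast; ring)
  have hcq : Continuous q := by fun_prop
  have hcq'' : Continuous q'' := by fun_prop
  have hsabs : ∀ s : ℝ, s * |s| ≤ s ^ 2 := fun s => by
    rw [← sq_abs, sq]
    exact mul_le_mul_of_nonneg_right (le_abs_self s) (abs_nonneg s)
  have hq_nonneg : ∀ s, 0 ≤ q s := fun s => by
    simp only [hq_def]
    nlinarith [mul_le_mul_of_nonneg_left (hsabs s) (sq_nonneg s)]
  have hq''_nonneg : ∀ s, 0 ≤ q'' s := fun s => by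
    simp only [hq''_def]
    linarith [hsabs s]
  set Q : ℝ → ℝ := fun t => ∫ x in (0:ℝ)..L, q (m t x) with hQ_def
  have hQc : Continuous Q := h.continuous_integral_comp_m hcq
  have hQd : ∀ t ∈ Ioo 0 T, DifferentiableAt ℝ Q t := fun t ht =>
    (h.hasDerivAt_integral_comp_m hL ht hq hq' hcq'').differentiableAt
  set K : ℝ := 6 * B / σ ^ 2 with hK_def
  have hQle : ∀ t ∈ Ioo 0 T, deriv Q t ≤ K * Q t := by
    intro t ht
    refine (h.deriv_integral_comp_m_le hL hσ ht hq hq' hcq'' (by simp [hq'_def])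
      hq''_nonneg).trans ?_
    rw [show K * Q t = 1 / (2 * σ ^ 2) * ∫ x in (0:ℝ)..L, 12 * q (m t x) * B by
      simp only [hQ_def, hK_def]
      rw [intervalIntegral.integral_mul_const, intervalIntegral.integral_const_mul]
      field_simp
      ring]
    have h3 := continuous_slice h.m_contDiff.continuous t
    have h4 := h.continuous_mfgG t
    refine mul_le_mul_of_nonneg_left (intervalIntegral.integral_mono_on hL.le
      (Continuous.intervalIntegrable (by fun_prop) _ _)
      (Continuous.intervalIntegrable (by fun_prop) _ _) fun x hx => ?_) (by positivity)
    have e : q'' (m t x) * m t x ^ 2 = 12 * q (m t x) := by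
      simp only [hq_def, hq''_def]; ring
    rw [e]
    exact mul_le_mul_of_nonneg_left (hB t ht x hx) (by linarith [hq_nonneg (m t x)])
  have hanti : AntitoneOn (fun t => Real.exp (-K * t) * Q t) (Icc 0 T) := by
    have hexp : ∀ t, HasDerivAt (fun t => Real.exp (-K * t)) (Real.exp (-K * t) * -K) t :=
      fun t => by simpa using ((hasDerivAt_id t).const_mul (-K)).exp
    refine antitoneOn_of_deriv_nonpos (convex_Icc 0 T) (by fun_prop) ?_ ?_
    · intro t ht
      rw [interior_Icc] at ht
      exact ((hexp t).mul (hQd t ht).hasDerivAt).differentiableAt.differentiableWithinAt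
    · intro t ht
      rw [interior_Icc] at ht
      have hder : deriv (fun t => Real.exp (-K * t) * Q t) t = _ :=
        ((hexp t).mul (hQd t ht).hasDerivAt).deriv
      rw [hder]
      nlinarith [mul_le_mul_of_nonneg_left (hQle t ht) (Real.exp_pos (-K * t)).le]
  have hq_zero : ∀ s, 0 ≤ s → q s = 0 := fun s hs => by
    simp only [hq_def, abs_of_nonneg hs]; ring
  have hQ0 : Q 0 = 0 := by
    simp only [hQ_def]
    refine intervalIntegral.integral_zero_ae (Filter.Eventually.of_forall fun x hx => ?_)
    rw [uIoc_of_le hL.le] at hx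
    have hx' : x ∈ Icc 0 L := ⟨hx.1.le, hx.2⟩
    rw [h.m_init x hx']
    exact hq_zero _ (hd.m0_nonneg x hx')
  intro t ht x hx
  by_contra! hneg
  have hpos : 0 < Q t := by
    refine intervalIntegral.integral_pos hL
      (hcq.comp (continuous_slice h.m_contDiff.continuous t)).continuousOn
      (fun x _ => hq_nonneg _) ⟨x, hx, ?_⟩
    simp only [hq_def, abs_of_neg hneg]
    nlinarith [pow_pos (neg_pos.2 hneg) 4]
  have h1 := hanti (left_mem_Icc.2 hd.hT.le) ht ht.1
  simp only [hQ0, mul_zero] at h1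
  exact absurd h1 (not_le.2 (mul_pos (Real.exp_pos _) hpos))

lemma mfgEta_nonneg (h : IsMFGSolution T L σ r ε uT m0 u m)
    (hd : MFGData T L σ r ε uT m0) : ∀ t ∈ Icc 0 T, 0 ≤ mfgEta L m t := fun t ht =>
  intervalIntegral.integral_nonneg hd.hL.le (h.m_nonneg hd t ht)

lemma mfgEta_le_one (h : IsMFGSolution T L σ r ε uT m0 u m)
    (hd : MFGData T L σ r ε uT m0) : ∀ t ∈ Icc 0 T, mfgEta L m t ≤ 1 := by
  have hL := hd.hL
  have hdη : ∀ t ∈ Ioo 0 T, HasDerivAt (mfgEta L m) (-(σ ^ 2 / 2 * pdx m t 0)) t := by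
    intro t ht
    have : HasDerivAt (mfgEta L m) _ t :=
      h.hasDerivAt_integral_comp_m hL ht (q := fun s => s) (q' := fun _ => 1)
        (q'' := fun _ => 0) hasDerivAt_id' (fun s => hasDerivAt_const s 1) continuous_const
    exact this.congr_deriv (by simp)
  have hanti : AntitoneOn (mfgEta L m) (Icc 0 T) := by
    refine antitoneOn_of_deriv_nonpos (convex_Icc 0 T)
      (h.continuous_integral_comp_m continuous_id).continuousOn ?_ ?_
    · intro t ht
      rw [interior_Icc] at ht
      exact (hdη t ht).differentiableAt.differentiableWithinAt
    · intro t ht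
      rw [interior_Icc] at ht
      have ht' : t ∈ Icc 0 T := ⟨ht.1.le, ht.2.le⟩
      have : 0 ≤ pdx m t 0 :=
        deriv_nonneg_of_forall_le hL (hasDerivAt_space h.m_contDiff t 0) fun x hx => by
          rw [h.m_bdry t ht']
          exact h.m_nonneg hd t ht' x hx
      rw [(hdη t ht).deriv, neg_nonpos]
      positivity
  intro t ht
  refine (hanti (left_mem_Icc.2 hd.hT.le) ht ht.1).trans_eq ?_
  rw [← hd.m0_mass]
  refine intervalIntegral.integral_congr fun x hx => ?_
  rw [uIcc_of_le hL.le] at hx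
  exact h.m_init x hx

lemma integral_pdx_u_mul_m_nonneg (h : IsMFGSolution T L σ r ε uT m0 u m)
    (hd : MFGData T L σ r ε uT m0) : ∀ t ∈ Icc 0 T, 0 ≤ ∫ x in (0:ℝ)..L, pdx u t x * m t x :=
  fun t ht => intervalIntegral.integral_nonneg hd.hL.le fun x hx =>
    mul_nonneg (h.pdx_u_nonneg hd t ht x hx) (h.m_nonneg hd t ht x hx)

lemma mfgF_nonneg (h : IsMFGSolution T L σ r ε uT m0 u m)
    (hd : MFGData T L σ r ε uT m0) : ∀ t ∈ Icc 0 T, 0 ≤ mfgF L ε u m t := fun t ht => by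
  have h1 := h.mfgEta_nonneg hd t ht
  have h2 := h.integral_pdx_u_mul_m_nonneg hd t ht
  have h3 := hd.hε
  unfold mfgF
  positivity

lemma mfgF_mul (h : IsMFGSolution T L σ r ε uT m0 u m)
    (hd : MFGData T L σ r ε uT m0) : ∀ t ∈ Icc 0 T,
    mfgF L ε u m t * (2 + ε * mfgEta L m t) =
      2 + ε * ∫ x in (0:ℝ)..L, pdx u t x * m t x := fun t ht => by
  have h1 := h.mfgEta_nonneg hd t ht
  have h3 := hd.hε
  have : 0 < 2 + ε * mfgEta L m t := by positivity
  unfold mfgF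
  field_simp

lemma mfgF_le (h : IsMFGSolution T L σ r ε uT m0 u m)
    (hd : MFGData T L σ r ε uT m0) : ∀ t ∈ Icc 0 T,
    mfgF L ε u m t ≤ 1 + ε / 2 * ∫ x in (0:ℝ)..L, pdx u t x * m t x := fun t ht => by
  have h1 := h.mfgEta_nonneg hd t ht
  have h2 := h.mfgF_nonneg hd t ht
  have h3 := hd.hε
  have h4 := h.mfgF_mul hd t ht
  nlinarith [mul_nonneg h2 (mul_nonneg h3 h1)]

/-- The energy identity, obtained by testing the Hamilton-Jacobi equation with `m` and the
Fokker-Planck equation with `u`. -/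
lemma hasDerivAt_integral_u_mul_m (h : IsMFGSolution T L σ r ε uT m0 u m) (hL : 0 < L) {t : ℝ}
    (ht : t ∈ Ioo 0 T) :
    HasDerivAt (fun t => ∫ x in (0:ℝ)..L, u t x * m t x)
      (r * (∫ x in (0:ℝ)..L, u t x * m t x)
        + (1 / 4) * ((∫ x in (0:ℝ)..L, (pdx u t x - mfgF L ε u m t) ^ 2 * m t x)
          + 2 * mfgF L ε u m t * ∫ x in (0:ℝ)..L, (pdx u t x - mfgF L ε u m t) * m t x)) t := by
  have ht' : t ∈ Icc 0 T := ⟨ht.1.le, ht.2.le⟩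
  have hd := hasDerivAt_integral_of_contDiff (g := fun t x => u t x * m t x)
    (h.u_contDiff.mul h.m_contDiff) 0 L t
  refine hd.congr_deriv ?_
  have hc1 := continuous_slice h.u_contDiff.continuous t
  have hc2 := continuous_slice h.pdx_u_contDiff.continuous t
  have hc3 := continuous_slice h.pdxx_u_contDiff.continuous t
  have hc4 := continuous_slice h.m_contDiff.continuous t
  have hc5 := continuous_slice h.pdx_m_contDiff.continuous t
  have hc6 := continuous_slice h.pdt_u_contDiff.continuous t
  have hc7 := continuous_slice (continuous_pdt h.m_contDiff) t
  have hc8 := h.continuous_mfgG t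
  have hweak := h.integral_mul_pdt_m hL ht (ψ := u t) (ψ' := pdx u t)
    (fun x => hasDerivAt_space h.u_contDiff t x) hc2
  rw [h.u_bdry t ht', zero_mul, neg_zero, zero_sub] at hweak
  have hparts := intervalIntegral.integral_mul_deriv_eq_deriv_mul (a := 0) (b := L)
    (fun x _ => hasDerivAt_space h.m_contDiff t x) (fun x _ => h.hasDerivAt_pdx_u t x)
    (hc5.intervalIntegrable _ _) (hc3.intervalIntegrable _ _)
  rw [h.m_bdry t ht', h.ux_bdry t ht', mul_zero, zero_mul, zero_sub, neg_zero, zero_sub] at hparts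
  have e1 : ∫ x in (0:ℝ)..L, pdt (fun t x => u t x * m t x) t x =
      (∫ x in (0:ℝ)..L, pdt u t x * m t x) + ∫ x in (0:ℝ)..L, u t x * pdt m t x := by
    rw [← intervalIntegral.integral_add (Continuous.intervalIntegrable (by fun_prop) _ _)
      (Continuous.intervalIntegrable (by fun_prop) _ _)]
    exact intervalIntegral.integral_congr fun x _ =>
      ((hasDerivAt_time h.u_contDiff t x).mul (hasDerivAt_time h.m_contDiff t x)).deriv
  rw [e1, hweak]
  have e2 : ∫ x in (0:ℝ)..L, pdt u t x * m t x =
      ∫ x in (0:ℝ)..L, (r * (u t x * m t x)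
        + (1 / 4) * ((pdx u t x - mfgF L ε u m t) ^ 2 * m t x
          + 2 * mfgF L ε u m t * ((pdx u t x - mfgF L ε u m t) * m t x))
        + pdx u t x * (σ ^ 2 / 2 * pdx m t x + mfgG L ε u m t x * m t x)
        - σ ^ 2 / 2 * (m t x * pdxx u t x) - σ ^ 2 / 2 * (pdx m t x * pdx u t x)) := by
    refine intervalIntegral.integral_congr fun x hx => ?_
    rw [uIcc_of_le hL.le] at hx
    have := h.hjb_Icc hL ht x hx
    have e : pdt u t x = r * u t x - σ ^ 2 / 2 * pdxx u t x - mfgG L ε u m t x ^ 2 := by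
      linarith
    simp only [e, mfgG]
    ring
  rw [e2]
  iterate 2
    rw [intervalIntegral.integral_sub (Continuous.intervalIntegrable (by fun_prop) _ _)
      (Continuous.intervalIntegrable (by fun_prop) _ _)]
  iterate 2
    rw [intervalIntegral.integral_add (Continuous.intervalIntegrable (by fun_prop) _ _)
      (Continuous.intervalIntegrable (by fun_prop) _ _)]
  simp only [intervalIntegral.integral_const_mul]
  rw [intervalIntegral.integral_add (Continuous.intervalIntegrable (by fun_prop) _ _)
      (Continuous.intervalIntegrable (by fun_prop) _ _), intervalIntegral.integral_const_mul,
    hparts]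
  ring

/-- Pointwise-in-time control of `f` by the dissipation. -/
lemma mfgF_estimates (h : IsMFGSolution T L σ r ε uT m0 u m)
    (hd : MFGData T L σ r ε uT m0) : ∀ t ∈ Icc 0 T,
    mfgF L ε u m t ^ 2 ≤
        2 + ε ^ 2 / 2 * ∫ x in (0:ℝ)..L, (pdx u t x - mfgF L ε u m t) ^ 2 * m t x ∧
      -2 ≤ 2 * mfgF L ε u m t * ∫ x in (0:ℝ)..L, (pdx u t x - mfgF L ε u m t) * m t x := by
  intro t ht
  have hc2 := continuous_slice h.pdx_u_contDiff.continuous t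
  have hc4 := continuous_slice h.m_contDiff.continuous t
  have hη0 := h.mfgEta_nonneg hd t ht
  have hη1 := h.mfgEta_le_one hd t ht
  have hf0 := h.mfgF_nonneg hd t ht
  have hp := h.integral_pdx_u_mul_m_nonneg hd t ht
  have hmul := h.mfgF_mul hd t ht
  set f := mfgF L ε u m t
  set d := ∫ x in (0:ℝ)..L, (pdx u t x - f) * m t x with hd_def
  set D := ∫ x in (0:ℝ)..L, (pdx u t x - f) ^ 2 * m t x with hD_def
  have e1 : d = (∫ x in (0:ℝ)..L, pdx u t x * m t x) - f * mfgEta L m t := by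
    rw [hd_def, mfgEta, ← intervalIntegral.integral_const_mul, ← intervalIntegral.integral_sub
      (Continuous.intervalIntegrable (by fun_prop) _ _)
      (Continuous.intervalIntegrable (by fun_prop) _ _)]
    exact intervalIntegral.integral_congr fun x _ => by ring
  have e2 : ∫ x in (0:ℝ)..L, (pdx u t x - f - d) ^ 2 * m t x =
      D - 2 * d * d + d ^ 2 * mfgEta L m t := by
    have : ∫ x in (0:ℝ)..L, (pdx u t x - f - d) ^ 2 * m t x =
        ∫ x in (0:ℝ)..L, ((pdx u t x - f) ^ 2 * m t x - 2 * d * ((pdx u t x - f) * m t x)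
          + d ^ 2 * m t x) :=
      intervalIntegral.integral_congr fun x _ => by ring
    rw [this, intervalIntegral.integral_add (Continuous.intervalIntegrable (by fun_prop) _ _)
        (Continuous.intervalIntegrable (by fun_prop) _ _),
      intervalIntegral.integral_sub (Continuous.intervalIntegrable (by fun_prop) _ _)
        (Continuous.intervalIntegrable (by fun_prop) _ _),
      intervalIntegral.integral_const_mul, intervalIntegral.integral_const_mul, mfgEta]
  have e3 : 0 ≤ ∫ x in (0:ℝ)..L, (pdx u t x - f - d) ^ 2 * m t x :=
    intervalIntegral.integral_nonneg hd.hL.le fun x hx =>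
      mul_nonneg (sq_nonneg _) (h.m_nonneg hd t ht x hx)
  rw [e2] at e3
  have hdD : d ^ 2 ≤ D := by nlinarith [sq_nonneg d]
  have hfd : f = 1 + ε * d / 2 := by rw [e1]; linarith
  constructor
  · rw [hfd]
    nlinarith [sq_nonneg (1 - ε * d / 2), mul_le_mul_of_nonneg_left hdD (sq_nonneg ε)]
  · rcases le_total 0 d with hd0 | hd0
    · nlinarith [mul_nonneg hf0 hd0]
    · have hf1 : f ≤ 1 := by
        have := mul_nonneg hd.hε (neg_nonneg.2 hd0)
        linarith
      have hd1 : -1 ≤ d := by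
        have := mul_le_one₀ hf1 hη0 hη1
        linarith
      nlinarith

/-- There is a monotone function of time, bounded in terms of the data, whose derivative
dominates `f²` and `∫ G² m`. -/
lemma exists_energy_bound (hd : MFGData T L σ r ε uT m0) :
    ∃ C : ℝ, ∀ u m : ℝ → ℝ → ℝ, IsMFGSolution T L σ r ε uT m0 u m →
      ∃ Ψ Ψ' : ℝ → ℝ, Continuous Ψ ∧ Ψ 0 = 0 ∧ Ψ T ≤ C ∧ ∀ t ∈ Ioo 0 T,
        HasDerivAt Ψ (Ψ' t) t ∧ mfgF L ε u m t ^ 2 ≤ Ψ' t ∧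
          ∫ x in (0:ℝ)..L, mfgG L ε u m t x ^ 2 * m t x ≤ Ψ' t := by
  have hL := hd.hL
  obtain ⟨N, hN⟩ := (isCompact_Icc (a := 0) (b := L)).exists_bound_of_continuousOn
    hd.uT_smooth.continuous.continuousOn
  refine ⟨2 * T + (1 + ε ^ 2) * (Real.exp (r * T) * (4 * N + 2 * T)), fun u m h => ?_⟩
  set S : ℝ → ℝ := fun t => ∫ x in (0:ℝ)..L, u t x * m t x with hS
  set D : ℝ → ℝ := fun t => ∫ x in (0:ℝ)..L, (pdx u t x - mfgF L ε u m t) ^ 2 * m t x with hD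
  set d : ℝ → ℝ := fun t => 2 * mfgF L ε u m t *
    ∫ x in (0:ℝ)..L, (pdx u t x - mfgF L ε u m t) * m t x with hd'
  have hSc : Continuous S :=
    (intervalIntegral.continuous_parametric_intervalIntegral_of_continuous'
      (f := fun t x => u t x * m t x)
      (h.u_contDiff.continuous.mul h.m_contDiff.continuous) _ _)
  set Φ : ℝ → ℝ := fun t => Real.exp (-r * t) * S t with hΦ
  have hΦd : ∀ t ∈ Ioo 0 T, HasDerivAt Φ (Real.exp (-r * t) * (1 / 4 * (D t + d t))) t := by
    intro t ht
    have hexp : HasDerivAt (fun t => Real.exp (-r * t)) (Real.exp (-r * t) * -r) t := by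
      simpa using ((hasDerivAt_id t).const_mul (-r)).exp
    exact (hexp.mul (h.hasDerivAt_integral_u_mul_m hL ht)).congr_deriv (by
      simp only [hD, hd']; ring)
  refine ⟨fun t => 2 * t + (1 + ε ^ 2) * (Real.exp (r * T) * (4 * (Φ t - Φ 0) + 2 * t)),
    fun t => 2 + (1 + ε ^ 2) *
      (Real.exp (r * T) * (Real.exp (-r * t) * (D t + d t) + 2)),
    by fun_prop, by simp, ?_, ?_⟩
  · have hT' : T ∈ Icc 0 T := right_mem_Icc.2 hd.hT.le
    have h0' : (0:ℝ) ∈ Icc 0 T := left_mem_Icc.2 hd.hT.le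
    have hΦ0 : 0 ≤ Φ 0 := mul_nonneg (Real.exp_pos _).le
      (intervalIntegral.integral_nonneg hL.le fun x hx =>
        mul_nonneg (h.u_nonneg hd 0 h0' x hx) (h.m_nonneg hd 0 h0' x hx))
    have hN0 : 0 ≤ N := (norm_nonneg _).trans (hN 0 (left_mem_Icc.2 hL.le))
    have hST : S T ≤ N := by
      have hc4 := continuous_slice h.m_contDiff.continuous T
      have hc1 := continuous_slice h.u_contDiff.continuous T
      calc S T ≤ ∫ x in (0:ℝ)..L, N * m T x := by
            refine intervalIntegral.integral_mono_on hL.le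
              (Continuous.intervalIntegrable (by fun_prop) _ _)
              (Continuous.intervalIntegrable (by fun_prop) _ _) fun x hx => ?_
            refine mul_le_mul_of_nonneg_right ?_ (h.m_nonneg hd T hT' x hx)
            rw [h.u_term x hx]
            exact (le_abs_self _).trans (hN x hx)
        _ = N * mfgEta L m T := by rw [intervalIntegral.integral_const_mul, mfgEta]
        _ ≤ N := mul_le_of_le_one_right hN0 (h.mfgEta_le_one hd T hT')
    have hΦT : Φ T ≤ N := by
      have he : Real.exp (-r * T) ≤ 1 := Real.exp_le_one_iff.2 (by nlinarith [hd.hr, hd.hT])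
      have hST0 : 0 ≤ S T := intervalIntegral.integral_nonneg hL.le fun x hx =>
        mul_nonneg (h.u_nonneg hd T hT' x hx) (h.m_nonneg hd T hT' x hx)
      exact (mul_le_of_le_one_left hST0 he).trans hST
    beta_reduce
    gcongr
    linarith
  · intro t ht
    have ht' : t ∈ Icc 0 T := ⟨ht.1.le, ht.2.le⟩
    have hD0 : 0 ≤ D t := intervalIntegral.integral_nonneg hL.le fun x hx =>
      mul_nonneg (sq_nonneg _) (h.m_nonneg hd t ht' x hx)
    obtain ⟨hf, hdt⟩ := h.mfgF_estimates hd t ht'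
    change -2 ≤ d t at hdt
    change _ ≤ 2 + ε ^ 2 / 2 * D t at hf
    have hDle : D t ≤ Real.exp (r * T) * (Real.exp (-r * t) * (D t + d t) + 2) := by
      have h1 : Real.exp (-r * t) ≤ 1 := Real.exp_le_one_iff.2 (by nlinarith [hd.hr, ht.1])
      have h2 : 1 ≤ Real.exp (r * T) * Real.exp (-r * t) := by
        rw [← Real.exp_add]
        exact Real.one_le_exp (by nlinarith [hd.hr, ht.2])
      have h3 : 0 ≤ Real.exp (-r * t) * (d t + 2) + (1 - Real.exp (-r * t)) * 2 :=
        add_nonneg (mul_nonneg (Real.exp_pos _).le (by linarith)) (by linarith)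
      nlinarith [mul_nonneg (Real.exp_pos (r * T)).le h3, mul_le_mul_of_nonneg_right h2 hD0]
    have hG : ∫ x in (0:ℝ)..L, mfgG L ε u m t x ^ 2 * m t x = 1 / 4 * D t := by
      rw [hD, ← intervalIntegral.integral_const_mul]
      exact intervalIntegral.integral_congr fun x _ => by simp only [mfgG]; ring
    refine ⟨?_, ?_, ?_⟩
    · refine (((hasDerivAt_id t).const_mul 2).add (((((hΦd t ht).sub_const (Φ 0)).const_mul 4).add
        ((hasDerivAt_id t).const_mul 2)).const_mul (Real.exp (r * T)) |>.const_mul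
          (1 + ε ^ 2))).congr_deriv ?_
      ring
    · nlinarith [mul_le_mul_of_nonneg_left hDle (sq_nonneg ε), mul_nonneg (sq_nonneg ε) hD0]
    · rw [hG]
      nlinarith [mul_le_mul_of_nonneg_left hDle (sq_nonneg ε), mul_nonneg (sq_nonneg ε) hD0]

lemma exists_u_bound (hd : MFGData T L σ r ε uT m0) :
    ∃ C : ℝ, ∀ u m : ℝ → ℝ → ℝ, IsMFGSolution T L σ r ε uT m0 u m →
      ∀ t ∈ Icc 0 T, ∀ x ∈ Icc 0 L, u t x ≤ C := by
  have hL := hd.hL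
  obtain ⟨N, hN⟩ := (isCompact_Icc (a := 0) (b := L)).exists_bound_of_continuousOn
    hd.uT_smooth.continuous.continuousOn
  have hN0 : 0 ≤ N := (norm_nonneg _).trans (hN 0 (left_mem_Icc.2 hL.le))
  obtain ⟨C, hC⟩ := exists_energy_bound hd
  refine ⟨N + 1 / 4 * C, fun u m h t ht x hx => ?_⟩
  obtain ⟨Ψ, Ψ', hΨc, hΨ0, hΨT, hΨ⟩ := hC u m h
  have hmono : MonotoneOn Ψ (Icc 0 T) := by
    refine monotoneOn_of_deriv_nonneg (convex_Icc 0 T) hΨc.continuousOn ?_ ?_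
    · intro t ht
      rw [interior_Icc] at ht
      exact (hΨ t ht).1.differentiableAt.differentiableWithinAt
    · intro t ht
      rw [interior_Icc] at ht
      rw [(hΨ t ht).1.deriv]
      exact (sq_nonneg _).trans (hΨ t ht).2.1
  have hT' : T ∈ Icc 0 T := right_mem_Icc.2 hd.hT.le
  have key : ∀ t ∈ Icc 0 T, 0 ≤ N + 1 / 4 * (Ψ T - Ψ t) - u t x := by
    refine nonneg_Icc_of_nonneg_Ioc hd.hT ?_ fun t₀ ht₀ => ?_
    · have := continuous_time_slice h.u_contDiff.continuous x
      fun_prop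
    have hsub : ∀ t ∈ Ico t₀ T, t ∈ Ioo 0 T := fun t ht => ⟨ht₀.1.trans_le ht.1, ht.2⟩
    have hle : ∀ t ∈ Ico t₀ T, 0 ≤ Ψ T - Ψ t := fun t ht =>
      sub_nonneg.2 (hmono ⟨(hsub t ht).1.le, ht.2.le⟩ hT' ht.2.le)
    refine parabolic_nonneg (a := t₀) (b := T) (l := L) hL
      (w := fun t x => N + 1 / 4 * (Ψ T - Ψ t) - u t x)
      (wt := fun t x => 1 / 4 * (-Ψ' t) - pdt u t x) (wx := fun t x => -pdx u t x)
      (wxx := fun t x => -pdxx u t x) ?_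
      (fun t ht x _ => ((((hΨ t (hsub t ht)).1.const_sub (Ψ T)).const_mul (1 / 4)).const_add N).sub
        (hasDerivAt_time h.u_contDiff t x))
      (fun t _ x _ => (hasDerivAt_space h.u_contDiff t x).const_sub _)
      (fun t _ x _ => (h.hasDerivAt_pdx_u t x).neg)
      (fun x hx => ?_) (fun t ht => ?_)
      (fun t ht => Or.inr (by rw [h.ux_bdry t ⟨(hsub t ht).1.le, ht.2.le⟩, neg_zero]))
      ?_ t₀ ⟨le_rfl, ht₀.2⟩ x hx
    · have h1 : Continuous (uncurry fun t x => N + 1 / 4 * (Ψ T - Ψ t) - u t x) :=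
        (continuous_const.add (continuous_const.mul
          (continuous_const.sub (hΨc.comp continuous_fst)))).sub h.u_contDiff.continuous
      exact h1.continuousOn
    · rw [h.u_term x hx]
      linarith [(le_abs_self _).trans (hN x hx)]
    · rw [h.u_bdry t ⟨(hsub t ht).1.le, ht.2.le⟩]
      linarith [hle t ht]
    · intro t ht x hx hneg hwx hwt hwxx
      have h1 := h.hjb_Icc hL (hsub t ht) x ⟨hx.1.le, hx.2⟩
      rw [mfgG, neg_eq_zero.1 hwx] at h1
      have h2 := (hΨ t (hsub t ht)).2.1
      have hr : 0 < r * u t x := mul_pos hd.hr (by linarith [hle t ht])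
      have : 0 ≤ σ ^ 2 / 2 * -pdxx u t x := mul_nonneg (by positivity) hwxx
      linarith
  have h1 := key t ht
  have h2 := hmono (left_mem_Icc.2 hd.hT.le) ht ht.1
  linarith

/-- The Fenchel-Young inequality for the pair `s arsinh s - √(1 + s²)`, `cosh`. -/
lemma mul_le_entropy_add_cosh (a s : ℝ) :
    a * s ≤ s * Real.arsinh s - √(1 + s ^ 2) + Real.cosh a := by
  rw [← Real.cosh_arsinh]
  nth_rewrite 1 [← Real.sinh_arsinh s]
  nth_rewrite 2 [← Real.sinh_arsinh s]
  set b := Real.arsinh s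
  rw [Real.cosh_eq, Real.cosh_eq, Real.sinh_eq]
  have h1 : Real.exp b * (1 + (a - b)) ≤ Real.exp a := by
    have := mul_le_mul_of_nonneg_left (Real.add_one_le_exp (a - b)) (Real.exp_pos b).le
    rw [← Real.exp_add, add_sub_cancel] at this
    linarith
  have h2 : Real.exp (-b) * (1 - (a - b)) ≤ Real.exp (-a) := by
    have := mul_le_mul_of_nonneg_left (Real.add_one_le_exp (b - a)) (Real.exp_pos (-b)).le
    rw [← Real.exp_add, show -b + (b - a) = -a by ring] at this
    linarith
  linarith

lemma exists_entropy_bound (hd : MFGData T L σ r ε uT m0) :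
    ∃ E : ℝ, ∀ u m : ℝ → ℝ → ℝ, IsMFGSolution T L σ r ε uT m0 u m → ∀ t ∈ Icc 0 T,
      ∫ x in (0:ℝ)..L, (m t x * Real.arsinh (m t x) - √(1 + m t x ^ 2) + 1) ≤ E := by
  have hL := hd.hL
  have hσ := hd.hσ
  obtain ⟨C, hC⟩ := exists_energy_bound hd
  set q : ℝ → ℝ := fun s => s * Real.arsinh s - √(1 + s ^ 2) + 1 with hq_def
  have hpos : ∀ s : ℝ, 0 < √(1 + s ^ 2) := fun s => Real.sqrt_pos.2 (by positivity)
  have hq : ∀ s, HasDerivAt q (Real.arsinh s) s := by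
    intro s
    have h1 : HasDerivAt (fun s : ℝ => √(1 + s ^ 2)) (s / √(1 + s ^ 2)) s := by
      have := ((hasDerivAt_pow 2 s).const_add 1).sqrt (by positivity : 1 + s ^ 2 ≠ 0)
      refine this.congr_deriv ?_
      have := hpos s
      field_simp
      norm_num
    refine ((((hasDerivAt_id s).mul (Real.hasDerivAt_arsinh s)).sub h1).add_const
      (1 : ℝ)).congr_deriv ?_
    simp only [id]
    rw [div_eq_mul_inv]
    ring
  have hq'' : Continuous fun s : ℝ => (√(1 + s ^ 2))⁻¹ :=
    Continuous.inv₀ (by fun_prop) fun s => (hpos s).ne'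
  refine ⟨(∫ x in (0:ℝ)..L, q (m0 x)) + 1 / (2 * σ ^ 2) * C, fun u m h t ht => ?_⟩
  obtain ⟨Ψ, Ψ', hΨc, hΨ0, hΨT, hΨ⟩ := hC u m h
  have hT' : T ∈ Icc 0 T := right_mem_Icc.2 hd.hT.le
  have h0' : (0:ℝ) ∈ Icc 0 T := left_mem_Icc.2 hd.hT.le
  have hmono : MonotoneOn Ψ (Icc 0 T) := by
    refine monotoneOn_of_deriv_nonneg (convex_Icc 0 T) hΨc.continuousOn ?_ ?_
    · intro t ht
      rw [interior_Icc] at ht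
      exact (hΨ t ht).1.differentiableAt.differentiableWithinAt
    · intro t ht
      rw [interior_Icc] at ht
      rw [(hΨ t ht).1.deriv]
      exact (sq_nonneg _).trans (hΨ t ht).2.1
  set Q : ℝ → ℝ := fun t => ∫ x in (0:ℝ)..L, q (m t x) with hQ_def
  have hcq : Continuous q := continuous_iff_continuousAt.2 fun s => (hq s).continuousAt
  have hQc : Continuous Q := h.continuous_integral_comp_m hcq
  have hQd : ∀ t ∈ Ioo 0 T, DifferentiableAt ℝ Q t := fun t ht =>
    (h.hasDerivAt_integral_comp_m hL ht hq Real.hasDerivAt_arsinh hq'').differentiableAt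
  have hQle : ∀ t ∈ Ioo 0 T, deriv Q t ≤ 1 / (2 * σ ^ 2) * Ψ' t := by
    intro t ht
    have ht' : t ∈ Icc 0 T := ⟨ht.1.le, ht.2.le⟩
    refine (h.deriv_integral_comp_m_le hL hσ ht hq Real.hasDerivAt_arsinh hq''
      Real.arsinh_zero fun s => (inv_pos.2 (hpos s)).le).trans ?_
    refine mul_le_mul_of_nonneg_left (le_trans ?_ (hΨ t ht).2.2) (by positivity)
    have h3 := continuous_slice h.m_contDiff.continuous t
    have h4 := h.continuous_mfgG t
    refine intervalIntegral.integral_mono_on hL.le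
      (Continuous.intervalIntegrable (((hq''.comp h3).mul (h3.pow 2)).mul (h4.pow 2)) _ _)
      (Continuous.intervalIntegrable (by fun_prop) _ _) fun x hx => ?_
    rw [mul_comm (mfgG L ε u m t x ^ 2)]
    refine mul_le_mul_of_nonneg_right ?_ (sq_nonneg _)
    have hm := h.m_nonneg hd t ht' x hx
    rw [inv_mul_le_iff₀ (hpos _)]
    have : m t x ≤ √(1 + m t x ^ 2) := Real.le_sqrt_of_sq_le (by linarith)
    nlinarith
  have hanti : AntitoneOn (fun t => Q t - 1 / (2 * σ ^ 2) * Ψ t) (Icc 0 T) := by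
    have hder : ∀ t ∈ Ioo 0 T, HasDerivAt (fun t => Q t - 1 / (2 * σ ^ 2) * Ψ t)
        (deriv Q t - 1 / (2 * σ ^ 2) * Ψ' t) t := fun t ht =>
      (hQd t ht).hasDerivAt.sub ((hΨ t ht).1.const_mul _)
    refine antitoneOn_of_deriv_nonpos (convex_Icc 0 T) (by fun_prop) ?_ ?_
    · intro t ht
      rw [interior_Icc] at ht
      exact (hder t ht).differentiableAt.differentiableWithinAt
    · intro t ht
      rw [interior_Icc] at ht
      rw [(hder t ht).deriv]
      linarith [hQle t ht]
  have h1 := hanti h0' ht ht.1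
  simp only [hΨ0, mul_zero, sub_zero] at h1
  have h2 : Q 0 = ∫ x in (0:ℝ)..L, q (m0 x) :=
    intervalIntegral.integral_congr fun x hx => by
      rw [uIcc_of_le hL.le] at hx
      simp only [h.m_init x hx]
  have h3 : 1 / (2 * σ ^ 2) * Ψ t ≤ 1 / (2 * σ ^ 2) * C :=
    mul_le_mul_of_nonneg_left ((hmono ht hT' ht.2).trans hΨT) (by positivity)
  change Q t ≤ _
  linarith

/-- The nonlocal term is controlled by an arbitrarily small multiple of `sup u_x`. -/
lemma mfgF_le_of_pdx_u_le (h : IsMFGSolution T L σ r ε uT m0 u m)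
    (hd : MFGData T L σ r ε uT m0) {C₀ E M a t : ℝ} (ht : t ∈ Icc 0 T)
    (hu : u t L ≤ C₀) (hM : ∀ x ∈ Icc 0 L, pdx u t x ≤ M)
    (hE : ∫ x in (0:ℝ)..L, (m t x * Real.arsinh (m t x) - √(1 + m t x ^ 2) + 1) ≤ E)
    (ha : 0 < a) :
    mfgF L ε u m t ≤ 1 + ε / 2 * ((M * E + Real.cosh a * C₀) / a) := by
  have hL := hd.hL
  have hv0 := h.pdx_u_nonneg hd t ht
  have hM0 : 0 ≤ M := (hv0 0 (left_mem_Icc.2 hL.le)).trans (hM 0 (left_mem_Icc.2 hL.le))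
  have hc2 := continuous_slice h.pdx_u_contDiff.continuous t
  have hc4 := continuous_slice h.m_contDiff.continuous t
  have hc5 : Continuous fun x => Real.arsinh (m t x) := hc4.arsinh
  refine (h.mfgF_le hd t ht).trans ?_
  have hε := hd.hε
  gcongr
  rw [le_div_iff₀ ha, mul_comm, ← intervalIntegral.integral_const_mul]
  have hv : ∫ x in (0:ℝ)..L, pdx u t x = u t L := by
    rw [intervalIntegral.integral_eq_sub_of_hasDerivAt
      (fun x _ => hasDerivAt_space h.u_contDiff t x) (hc2.intervalIntegrable _ _),
      h.u_bdry t ht, sub_zero]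
  calc ∫ x in (0:ℝ)..L, a * (pdx u t x * m t x)
      ≤ ∫ x in (0:ℝ)..L, (M * (m t x * Real.arsinh (m t x) - √(1 + m t x ^ 2) + 1)
          + Real.cosh a * pdx u t x) := by
        refine intervalIntegral.integral_mono_on hL.le
          (Continuous.intervalIntegrable (by fun_prop) _ _)
          (Continuous.intervalIntegrable (by fun_prop) _ _) fun x hx => ?_
        have h1 := mul_le_entropy_add_cosh a (m t x)
        have h2 := mul_le_entropy_add_cosh 0 (m t x)
        rw [zero_mul, Real.cosh_zero] at h2
        have h3 := mul_le_mul_of_nonneg_left h1 (hv0 x hx)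
        have h4 := mul_le_mul_of_nonneg_right (hM x hx) h2
        linarith [hv0 x hx]
    _ = M * (∫ x in (0:ℝ)..L, (m t x * Real.arsinh (m t x) - √(1 + m t x ^ 2) + 1))
          + Real.cosh a * u t L := by
        rw [intervalIntegral.integral_add (Continuous.intervalIntegrable (by fun_prop) _ _)
          (Continuous.intervalIntegrable (by fun_prop) _ _), intervalIntegral.integral_const_mul,
          intervalIntegral.integral_const_mul, hv]
    _ ≤ M * E + Real.cosh a * C₀ := by
        have := (Real.cosh_pos a).le
        gcongr

/-- A barrier estimate for the boundary gradient, linear in `sup f`. -/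
lemma exists_boundary_gradient_bound (hd : MFGData T L σ r ε uT m0) :
    ∃ C : ℝ, 0 ≤ C ∧ ∀ u m : ℝ → ℝ → ℝ, IsMFGSolution T L σ r ε uT m0 u m →
      ∀ F : ℝ, 1 ≤ F → 1 / L ≤ F → (∀ t ∈ Ioo 0 T, mfgF L ε u m t ≤ F) →
        ∀ t ∈ Ioo 0 T, pdx u t 0 ≤ C * F := by
  have hL := hd.hL
  have hσ := hd.hσ
  obtain ⟨C₀, hC₀⟩ := exists_u_bound hd
  set k : ℝ := 1 / (2 * σ ^ 2) with hk
  have hk0 : 0 < k := by positivity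
  set A : ℝ := Real.exp (k * C₀) with hA
  have hA0 : 0 < A := Real.exp_pos _
  have hφT : ContDiff ℝ 2 fun x => Real.exp (k * uT x) := (contDiff_const.mul hd.uT_smooth).exp
  obtain ⟨N, hN⟩ := (isCompact_Icc (a := 0) (b := L)).exists_bound_of_continuousOn
    (hφT.continuous_deriv (by simp)).continuousOn
  have hN0 : 0 ≤ N := (norm_nonneg _).trans (hN 0 (left_mem_Icc.2 hL.le))
  have hφT_le : ∀ x ∈ Icc 0 L, Real.exp (k * uT x) ≤ 1 + N * x := by
    intro x hx
    have := (convex_Icc 0 L).norm_image_sub_le_of_norm_deriv_le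
      (fun y _ => (hφT.differentiable (by simp)) y) hN (left_mem_Icc.2 hL.le) hx
    rw [hd.uT_zero, mul_zero, Real.exp_zero, sub_zero, Real.norm_of_nonneg hx.1] at this
    linarith [(le_abs_self _).trans this]
  set g : ℝ := k * A / (2 * σ ^ 2) with hg
  have hg0 : 0 < g := by positivity
  refine ⟨(A + N + g) / k, by positivity, fun u m h F hF1 hFL hF t₀ ht₀ => ?_⟩
  have hF0 : 0 < F := by linarith
  set δ : ℝ := 1 / F with hδ
  have hδ0 : 0 < δ := by positivity
  have hδL : δ ≤ L := by
    rw [hδ, div_le_iff₀ hF0]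
    rw [div_le_iff₀ hL] at hFL
    linarith
  have hFδ : ∀ x ∈ Icc 0 δ, F * x ≤ 1 := fun x hx => by
    have := hx.2
    rw [hδ, le_div_iff₀ hF0] at this
    linarith
  have hB : ∀ x ∈ Icc 0 δ, 1 + (A + N) * (F * x) ≤
      1 + (A + N + g) * F * x - g * F ^ 2 * x ^ 2 := fun x hx => by
    have := mul_nonneg (mul_nonneg hg0.le (mul_nonneg hF0.le hx.1)) (sub_nonneg.2 (hFδ x hx))
    linarith
  have hsub : ∀ t ∈ Ico t₀ T, t ∈ Ioo 0 T := fun t ht => ⟨ht₀.1.trans_le ht.1, ht.2⟩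
  have hφA : ∀ t ∈ Icc 0 T, ∀ x ∈ Icc 0 L, Real.exp (k * u t x) ≤ A := fun t ht x hx =>
    Real.exp_le_exp.2 (mul_le_mul_of_nonneg_left (hC₀ u m h t ht x hx) hk0.le)
  have hφt : ∀ t x, HasDerivAt (fun s => Real.exp (k * u s x))
      (Real.exp (k * u t x) * (k * pdt u t x)) t := fun t x =>
    ((hasDerivAt_time h.u_contDiff t x).const_mul k).exp
  have hφx : ∀ t x, HasDerivAt (fun y => Real.exp (k * u t y))
      (Real.exp (k * u t x) * (k * pdx u t x)) x := fun t x =>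
    ((hasDerivAt_space h.u_contDiff t x).const_mul k).exp
  have hφxx : ∀ t x, HasDerivAt (fun y => Real.exp (k * u t y) * (k * pdx u t y))
      (Real.exp (k * u t x) * (k * pdx u t x) * (k * pdx u t x)
        + Real.exp (k * u t x) * (k * pdxx u t x)) x := fun t x =>
    (hφx t x).mul ((h.hasDerivAt_pdx_u t x).const_mul k)
  have hBx : ∀ x, HasDerivAt (fun x => 1 + (A + N + g) * F * x - g * F ^ 2 * x ^ 2)
      ((A + N + g) * F - 2 * g * F ^ 2 * x) x := fun x =>
    ((((hasDerivAt_id x).const_mul ((A + N + g) * F)).const_add 1).sub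
      ((hasDerivAt_pow 2 x).const_mul (g * F ^ 2))).congr_deriv (by simp; ring)
  have hBxx : ∀ x, HasDerivAt (fun x => (A + N + g) * F - 2 * g * F ^ 2 * x)
      (-(2 * g * F ^ 2)) x := fun x =>
    (((hasDerivAt_id x).const_mul (2 * g * F ^ 2)).const_sub
      ((A + N + g) * F)).congr_deriv (by simp)
  have key : ∀ t ∈ Icc t₀ T, ∀ x ∈ Icc 0 δ,
      0 ≤ 1 + (A + N + g) * F * x - g * F ^ 2 * x ^ 2 - Real.exp (k * u t x) := by
    refine parabolic_nonneg (a := t₀) (b := T) (l := δ) hδ0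
      (w := fun t x => 1 + (A + N + g) * F * x - g * F ^ 2 * x ^ 2 - Real.exp (k * u t x))
      (wt := fun t x => -(Real.exp (k * u t x) * (k * pdt u t x)))
      (wx := fun t x => (A + N + g) * F - 2 * g * F ^ 2 * x
        - Real.exp (k * u t x) * (k * pdx u t x))
      (wxx := fun t x => -(2 * g * F ^ 2)
        - (Real.exp (k * u t x) * (k * pdx u t x) * (k * pdx u t x)
        + Real.exp (k * u t x) * (k * pdxx u t x))) ?_
      (fun t _ x _ => (hφt t x).const_sub _) (fun t _ x _ => (hBx x).sub (hφx t x))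
      (fun t _ x _ => (hBxx x).sub (hφxx t x)) (fun x hx => ?_) (fun t ht => ?_)
      (fun t ht => Or.inl ?_) ?_
    · have hu : Continuous fun p : ℝ × ℝ => u p.1 p.2 := h.u_contDiff.continuous
      have h1 : Continuous fun p : ℝ × ℝ =>
        1 + (A + N + g) * F * p.2 - g * F ^ 2 * p.2 ^ 2 - Real.exp (k * u p.1 p.2) := by fun_prop
      exact h1.continuousOn
    · have hxL : x ∈ Icc 0 L := ⟨hx.1, hx.2.trans hδL⟩
      rw [h.u_term x hxL]
      have h1 := hφT_le x hxL
      have h2 := hB x hx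
      have h3 : 0 ≤ A * (F * x) := mul_nonneg hA0.le (mul_nonneg hF0.le hx.1)
      have h4 : 0 ≤ N * ((F - 1) * x) := mul_nonneg hN0 (mul_nonneg (by linarith) hx.1)
      linarith
    · rw [h.u_bdry t ⟨(hsub t ht).1.le, ht.2.le⟩]
      simp
    · have h1 := hB δ (right_mem_Icc.2 hδ0.le)
      have h2 := hφA t ⟨(hsub t ht).1.le, ht.2.le⟩ δ ⟨hδ0.le, hδL⟩
      have h3 : F * δ = 1 := by rw [hδ]; field_simp
      rw [h3] at h1
      linarith
    · intro t ht x hx _ _ hwt hwxx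
      have ht' : t ∈ Icc 0 T := ⟨(hsub t ht).1.le, ht.2.le⟩
      have hxL : x ∈ Icc 0 L := ⟨hx.1.le, hx.2.trans hδL⟩
      have h1 := h.hjb_Icc hL (hsub t ht) x hxL
      have h2 := hφA t ht' x hxL
      have h3 := h.mfgF_nonneg hd t ht'
      have h4 := hF t (hsub t ht)
      have h5 := h.pdx_u_nonneg hd t ht' x hxL
      have h6 := mul_nonneg hd.hr.le (h.u_nonneg hd t ht' x hxL)
      have hpos := Real.exp_pos (k * u t x)
      set φ := Real.exp (k * u t x)
      set f := mfgF L ε u m t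
      have hσk : σ ^ 2 / 2 * k = 1 / 4 := by rw [hk]; field_simp; norm_num
      have h7 := mul_nonneg (by positivity : 0 ≤ σ ^ 2 / 2) hwxx
      have h8 : pdt u t x + σ ^ 2 / 2 * pdxx u t x
          = r * u t x - (1 / 2 * (f - pdx u t x)) ^ 2 := by
        rw [mfgG] at h1; linarith
      have h9 : φ * k * (pdt u t x + σ ^ 2 / 2 * pdxx u t x + 1 / 4 * pdx u t x ^ 2)
          ≤ -(σ ^ 2 * g * F ^ 2) := by
        rw [← hσk]
        linarith
      have h10 : σ ^ 2 * g = k * A / 2 := by rw [hg]; field_simp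
      rw [h8, h10] at h9
      have hfF : f ^ 2 ≤ F ^ 2 := pow_le_pow_left₀ h3 h4 2
      have h11 : -(F ^ 2 / 4) ≤ r * u t x - (1 / 2 * (f - pdx u t x)) ^ 2
          + 1 / 4 * pdx u t x ^ 2 := by
        linarith [mul_nonneg h3 h5]
      have h12 := mul_le_mul_of_nonneg_left h11 (mul_pos hpos hk0).le
      have h13 : φ * k * (F ^ 2 / 4) ≤ A * k * (F ^ 2 / 4) := by gcongr
      have h14 : 0 < A * k * F ^ 2 := by positivity
      linarith
  have ht₀' : t₀ ∈ Icc 0 T := ⟨ht₀.1.le, ht₀.2.le⟩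
  have hfin := deriv_nonneg_of_forall_le hδ0 ((hBx 0).sub (hφx t₀ 0)) fun x hx => by
    have := key t₀ ⟨le_rfl, ht₀.2.le⟩ x hx
    simpa [h.u_bdry t₀ ht₀'] using this
  rw [h.u_bdry t₀ ht₀', mul_zero, mul_zero, Real.exp_zero, one_mul, sub_zero] at hfin
  rw [div_mul_eq_mul_div, le_div_iff₀ hk0]
  linarith

end IsMFGSolution

end Solution

/-- gradient bound 0 ≤ u_x(t,x) ≤ C with C depending only on the data. -/
theorem mfg_gradient_bound (T L σ r ε : ℝ) (uT m0 : ℝ → ℝ)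
    (hdata : MFGData T L σ r ε uT m0) :
    ∃ C : ℝ, 0 < C ∧
      ∀ u m : ℝ → ℝ → ℝ, IsMFGSolution T L σ r ε uT m0 u m →
        ∀ t ∈ Icc (0:ℝ) T, ∀ x ∈ Icc (0:ℝ) L,
          0 ≤ pdx u t x ∧ pdx u t x ≤ C := by
  have hL := hdata.hL
  have hε := hdata.hε
  obtain ⟨C₀, hC₀⟩ := IsMFGSolution.exists_u_bound hdata
  obtain ⟨E, hE⟩ := IsMFGSolution.exists_entropy_bound hdata
  obtain ⟨C₁, hC₁0, hC₁⟩ := IsMFGSolution.exists_boundary_gradient_bound hdata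
  obtain ⟨N, hN⟩ := (isCompact_Icc (a := 0) (b := L)).exists_bound_of_continuousOn
    (hdata.uT_smooth.continuous_deriv (by simp)).continuousOn
  have hN0 : 0 ≤ N := (norm_nonneg _).trans (hN 0 (left_mem_Icc.2 hL.le))
  set a : ℝ := 1 + C₁ * ε * |E| with ha
  have ha0 : 0 < a := by positivity
  set K : ℝ := 2 * (N + C₁ * (1 + 1 / L + ε / 2 * (Real.cosh a * |C₀| / a))) with hK
  have hK0 : 0 ≤ K := by
    have := (Real.cosh_pos a).le
    positivity
  refine ⟨K + 1, by linarith, fun u m h t ht x hx => ⟨h.pdx_u_nonneg hdata t ht x hx, ?_⟩⟩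
  obtain ⟨⟨t₁, x₁⟩, ⟨ht₁, hx₁⟩, hmax⟩ := (isCompact_Icc.prod isCompact_Icc).exists_isMaxOn
    ⟨(t, x), ht, hx⟩ (h.pdx_u_contDiff.continuous.continuousOn)
  have hmax' : ∀ s ∈ Icc 0 T, ∀ y ∈ Icc 0 L, pdx u s y ≤ pdx u t₁ x₁ := fun s hs y hy =>
    hmax (a := (s, y)) ⟨hs, hy⟩
  have hM0 := h.pdx_u_nonneg hdata t₁ ht₁ x₁ hx₁
  set M := pdx u t₁ x₁ with hM
  set F : ℝ := 1 + 1 / L + ε / 2 * ((M * |E| + Real.cosh a * |C₀|) / a) with hF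
  have hrest : 0 ≤ ε / 2 * ((M * |E| + Real.cosh a * |C₀|) / a) := by
    have := (Real.cosh_pos a).le
    positivity
  have hL1 : 0 ≤ 1 / L := by positivity
  have hfF : ∀ s ∈ Ioo 0 T, mfgF L ε u m s ≤ F := by
    intro s hs
    have hs' : s ∈ Icc 0 T := ⟨hs.1.le, hs.2.le⟩
    have := h.mfgF_le_of_pdx_u_le hdata hs'
      ((hC₀ u m h s hs' L (right_mem_Icc.2 hL.le)).trans (le_abs_self _)) (hmax' s hs')
      ((hE u m h s hs').trans (le_abs_self _)) ha0
    linarith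
  have hleft := hC₁ u m h F (by linarith) (by linarith) hfF
  have hF0 : 0 ≤ C₁ * F := mul_nonneg hC₁0 (by linarith)
  have hMle : M ≤ N + C₁ * F := h.pdx_u_le hdata (by linarith)
    (fun y hy => by linarith [(le_abs_self _).trans (hN y hy)])
    (fun s hs => by linarith [hleft s hs]) t₁ ht₁ x₁ hx₁
  have hsmall : C₁ * (ε / 2 * (M * |E| / a)) ≤ M / 2 := by
    rw [show C₁ * (ε / 2 * (M * |E| / a)) = C₁ * ε * |E| / a * (M / 2) by ring]
    exact mul_le_of_le_one_left (by linarith) ((div_le_one ha0).2 (by linarith))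
  have hsplit : C₁ * F = C₁ * (1 + 1 / L + ε / 2 * (Real.cosh a * |C₀| / a))
      + C₁ * (ε / 2 * (M * |E| / a)) := by
    rw [hF]; ring
  linarith [hmax' t ht x hx]
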